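/- arXiv:2304.13213 — 2 statements merged into one kernel-verified Lean document; each statement's English description precedes it below -/
import Mathlib

section
/- Let p be an odd prime and q a power of p. Let A, B ⊆ F_q with |A| = m ≥ 2, |B| = n ≥ 2, and mn ≤ q. Let s1 be the largest non-negative integer such that p^{s1}·n ≤ q, and let s2 be the largest non-negative integer such that p^{s2}·m ≤ q. Then the set of directions determined by the Cartesian product A × B in AG(2,q) has size at least mn - min{ p^{s1}(n-1), p^{s2}(m-1) } + 1. -/
/-- The set of directions determined by a point set `U ⊆ AG(2,F)`, as a subset of
`Option F`, where `none` represents the vertical direction `∞` and `some m` the slope `m`. -/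
def directionSet (F : Type*) [Field F] (U : Set (F × F)) : Set (Option F) :=
  {x | ∃ P ∈ U, ∃ Q ∈ U, P ≠ Q ∧
    ((P.1 = Q.1 ∧ x = none) ∨ (P.1 ≠ Q.1 ∧ x = some ((Q.2 - P.2) / (Q.1 - P.1))))}

open Polynomial

/-- The polynomial `P` in `x` with coefficients in `R[y]` has total degree at most `d`. -/
def TotalDegreeLE {R : Type*} [CommRing R] (P : R[X][X]) (d : ℕ) : Prop :=
  ∀ i j, d < i + j → (P.coeff j).coeff i = 0

namespace TotalDegreeLE

variable {R : Type*} [CommRing R] {P Q : R[X][X]} {d e : ℕ}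

theorem sub (hP : TotalDegreeLE P d) (hQ : TotalDegreeLE Q d) : TotalDegreeLE (P - Q) d := by
  intro i j h
  simp [hP i j h, hQ i j h]

theorem mul (hP : TotalDegreeLE P d) (hQ : TotalDegreeLE Q e) :
    TotalDegreeLE (P * Q) (d + e) := by
  intro i j h
  rw [coeff_mul, finsetSum_coeff]
  refine Finset.sum_eq_zero fun x hx => ?_
  rw [coeff_mul]
  refine Finset.sum_eq_zero fun z hz => ?_
  rw [Finset.HasAntidiagonal.mem_antidiagonal] at hx hz
  rcases lt_or_ge d (z.1 + x.1) with h1 | h1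
  · rw [hP _ _ h1, zero_mul]
  · rw [hQ z.2 x.2 (by omega), mul_zero]

theorem one : TotalDegreeLE (1 : R[X][X]) 0 := by
  intro i j h
  rw [coeff_one]
  split_ifs with hj
  · rw [coeff_one, if_neg (by omega)]
  · simp

theorem X : TotalDegreeLE (X : R[X][X]) 1 := by
  intro i j h
  rw [coeff_X]
  split_ifs with hj
  · rw [coeff_one, if_neg (by omega)]
  · simp

theorem C {f : R[X]} (hf : f.natDegree ≤ d) : TotalDegreeLE (C f) d := by
  intro i j h
  rw [coeff_C]
  split_ifs with hj
  · exact coeff_eq_zero_of_natDegree_lt (by omega)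
  · simp

theorem mono (hP : TotalDegreeLE P d) (h : d ≤ e) : TotalDegreeLE P e :=
  fun i j hij => hP i j (h.trans_lt hij)

theorem prod {ι : Type*} (s : Finset ι) (f : ι → R[X][X]) (hf : ∀ i ∈ s, TotalDegreeLE (f i) 1) :
    TotalDegreeLE (∏ i ∈ s, f i) s.card := by
  classical
  induction s using Finset.induction_on with
  | empty => simpa using one
  | insert a s ha ih =>
    rw [Finset.prod_insert ha, Finset.card_insert_of_notMem ha, add_comm]
    exact (hf a (by simp)).mul (ih fun i hi => hf i (by simp [hi]))

theorem natDegree_coeff_le (hP : TotalDegreeLE P d) (j : ℕ) :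
    (P.coeff j).natDegree ≤ d - j :=
  natDegree_le_iff_coeff_eq_zero.mpr fun i hi => hP i j (by omega)

/-- Reducing `x ^ N` modulo a monic polynomial whose total degree is its degree in `x` does not
increase the total degree. -/
theorem exists_remainder [Nontrivial R] (hP : P.Monic) (hd : 0 < P.natDegree)
    (h : TotalDegreeLE P P.natDegree) (N : ℕ) :
    ∃ g : R[X][X], P ∣ Polynomial.X ^ N - g ∧ g.degree < P.natDegree ∧ TotalDegreeLE g N := by
  induction N with
  | zero =>
    refine ⟨1, by simp, ?_, one⟩
    rw [degree_one]
    exact_mod_cast hd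
  | succ N ih =>
    obtain ⟨g, hdvd, hdeg, hg⟩ := ih
    set c := g.coeff (P.natDegree - 1) with hc
    refine ⟨Polynomial.X * g - Polynomial.C c * P, ?_, ?_, ?_⟩
    · have : Polynomial.X ^ (N + 1) - (Polynomial.X * g - Polynomial.C c * P) =
          Polynomial.X * (Polynomial.X ^ N - g) + Polynomial.C c * P := by ring
      rw [this]
      exact dvd_add (hdvd.mul_left _) (dvd_mul_left _ _)
    · rw [degree_lt_iff_coeff_zero] at hdeg ⊢
      intro j hj
      obtain ⟨k, rfl⟩ : ∃ k, j = k + 1 := ⟨j - 1, by omega⟩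
      rw [coeff_sub, coeff_X_mul, coeff_C_mul]
      rcases hj.eq_or_lt with h1 | h1
      · rw [← h1, hP.coeff_natDegree, hc, h1]
        simp
      · rw [hdeg k (by omega), coeff_eq_zero_of_natDegree_lt h1]
        simp
    · refine sub ((X.mul hg).mono (by omega)) ?_
      by_cases hc0 : c = 0
      · intro i j _
        simp [hc0]
      · have hle : P.natDegree - 1 ≤ N := by
          by_contra! hlt
          exact hc0 (by ext i; exact hg i _ (by omega))
        exact ((C (hg.natDegree_coeff_le _)).mul h).mono (by omega)

end TotalDegreeLE

section Field

variable {F : Type*} [Field F]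

theorem prod_X_sub_C_pow_dvd_of_dvd_pow {p : ℕ} (B : Finset F) {M M' : ℕ} (hM : p * M' < M + p)
    {Q : F[X]} (hQ : Q ≠ 0) (h : (∏ b ∈ B, (X - C b)) ^ M ∣ Q ^ p) :
    (∏ b ∈ B, (X - C b)) ^ M' ∣ Q := by
  classical
  rw [← Finset.prod_pow]
  refine Finset.prod_dvd_of_coprime ?_ ?_
  · intro a _ b _ hab
    exact (isCoprime_X_sub_C_of_isUnit_sub (sub_ne_zero.mpr hab).isUnit).pow
  · intro b hb
    have h1 : (X - C b) ^ M ∣ Q ^ p :=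
      (pow_dvd_pow_of_dvd (Finset.dvd_prod_of_mem (fun b => X - C b) hb) M).trans h
    rw [← le_rootMultiplicity_iff (pow_ne_zero _ hQ), ← count_roots, roots_pow,
      Multiset.count_nsmul, count_roots] at h1
    rw [← le_rootMultiplicity_iff hQ]
    by_contra! hlt
    have : p * (rootMultiplicity b Q + 1) ≤ p * M' := Nat.mul_le_mul_left p hlt
    rw [mul_add] at this
    omega

theorem pow_pred_dvd_derivative {P Q : F[X]} {M : ℕ} (h : P ^ M ∣ Q) :
    P ^ (M - 1) ∣ derivative Q := by
  obtain ⟨f, rfl⟩ := h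
  rw [derivative_mul, derivative_pow]
  refine dvd_add ?_ ((pow_dvd_pow P (Nat.sub_le M 1)).mul_right _)
  exact ((dvd_mul_left _ _).mul_right _).mul_right _

/-- If `∏ (x - b) ^ M` divides the lacunary polynomial `x ^ (p ^ r) - g`, then the degree of `g`
is large. -/
theorem exists_le_natDegree_of_pow_dvd_X_pow_sub (p : ℕ) [Fact p.Prime] [CharP F p]
    [PerfectRing F p] (B : Finset F) (hB : 2 ≤ B.card) (r : ℕ) :
    ∀ (M : ℕ) (g : F[X]), 0 < M → g.natDegree < p ^ r →
      (∏ b ∈ B, (X - C b)) ^ M ∣ X ^ p ^ r - g →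
      ∃ t, p ^ t * B.card ≤ p ^ r ∧ M * B.card ≤ g.natDegree + p ^ t * (B.card - 1) := by
  have hp : p.Prime := Fact.out
  have hBdeg : (∏ b ∈ B, (X - C b)).natDegree = B.card := natDegree_finsetProd_X_sub_C_eq_card B id
  have hdeg (r : ℕ) (g : F[X]) (hg : g.natDegree < p ^ r) :
      (X ^ p ^ r - g).natDegree = p ^ r := by
    rw [natDegree_sub_eq_left_of_natDegree_lt (by simpa using hg), natDegree_X_pow]
  have hne (r : ℕ) (g : F[X]) (hg : g.natDegree < p ^ r) : X ^ p ^ r - g ≠ 0 := by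
    intro h0
    have := hdeg r g hg
    rw [h0, natDegree_zero] at this
    omega
  have hcard (r M : ℕ) (g : F[X]) (hM : 0 < M) (hg : g.natDegree < p ^ r)
      (h : (∏ b ∈ B, (X - C b)) ^ M ∣ X ^ p ^ r - g) : B.card ≤ p ^ r := by
    rw [← hBdeg, ← hdeg r g hg]
    exact natDegree_le_of_dvd ((dvd_pow_self _ hM.ne').trans h) (hne r g hg)
  induction r with
  | zero =>
    intro M g hM hg h
    have := hcard 0 M g hM hg h
    simp at this
    omega
  | succ r ih =>
    intro M g hM hg h
    by_cases hg' : derivative g = 0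
    · obtain ⟨f, rfl⟩ : ∃ f : F[X], g = f ^ p :=
        ⟨_, by rw [← polynomial_expand_eq, expand_contract p hg' hp.ne_zero]⟩
      rw [natDegree_pow, pow_succ', Nat.mul_lt_mul_left hp.pos] at hg
      rw [pow_succ, pow_mul, ← sub_pow_char] at h
      obtain ⟨M', hM', hM''⟩ : ∃ M', M ≤ p * M' ∧ p * M' < M + p := by
        refine ⟨(M + p - 1) / p, ?_, ?_⟩
        · have := Nat.div_add_mod (M + p - 1) p
          have := Nat.mod_lt (M + p - 1) hp.pos
          omega
        · have := Nat.mul_div_le (M + p - 1) p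
          omega
      obtain ⟨t, ht1, ht2⟩ := ih M' f (Nat.pos_of_ne_zero (by rintro rfl; omega)) hg
        (prod_X_sub_C_pow_dvd_of_dvd_pow B hM'' (hne r f hg) h)
      refine ⟨t + 1, ?_, ?_⟩
      · rw [pow_succ', pow_succ', mul_assoc]
        exact Nat.mul_le_mul_left p ht1
      · rw [natDegree_pow, pow_succ', mul_assoc, ← mul_add]
        refine le_trans ?_ (Nat.mul_le_mul_left p ht2)
        rw [← mul_assoc]
        exact Nat.mul_le_mul_right _ hM'
    · refine ⟨0, by simpa using hcard _ M g hM hg h, ?_⟩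
      have h1 := pow_pred_dvd_derivative h
      have h2 : derivative (X ^ p ^ (r + 1) - g) = -derivative g := by
        simp [derivative_X_pow]
      rw [h2, dvd_neg] at h1
      have h3 := natDegree_le_of_dvd h1 hg'
      rw [natDegree_pow, hBdeg] at h3
      have h4 : g.natDegree ≠ 0 := fun h0 => hg' (derivative_of_natDegree_zero h0)
      have h5 := natDegree_derivative_lt h4
      obtain ⟨M, rfl⟩ : ∃ k, M = k + 1 := ⟨M - 1, by omega⟩
      rw [Nat.add_sub_cancel] at h3
      rw [add_mul, pow_zero]
      omega

theorem none_mem_directionSet {A B : Finset F} (hA : 2 ≤ A.card) (hB : 2 ≤ B.card) :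
    none ∈ directionSet F {P : F × F | P.1 ∈ A ∧ P.2 ∈ B} := by
  obtain ⟨a, ha⟩ := Finset.card_pos.mp (by omega : 0 < A.card)
  obtain ⟨b, hb, c, hc, hbc⟩ := Finset.one_lt_card.mp hB
  exact ⟨(a, b), ⟨ha, hb⟩, (a, c), ⟨ha, hc⟩, by simp [hbc], Or.inl ⟨rfl, rfl⟩⟩

theorem some_zero_mem_directionSet {A B : Finset F} (hA : 2 ≤ A.card) (hB : 2 ≤ B.card) :
    some 0 ∈ directionSet F {P : F × F | P.1 ∈ A ∧ P.2 ∈ B} := by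
  obtain ⟨b, hb⟩ := Finset.card_pos.mp (by omega : 0 < B.card)
  obtain ⟨a, ha, c, hc, hac⟩ := Finset.one_lt_card.mp hA
  exact ⟨(a, b), ⟨ha, hb⟩, (c, b), ⟨hc, hb⟩, by simp [hac], Or.inr ⟨hac, by simp⟩⟩

theorem injOn_sub_mul_of_notMem_directionSet {U : Set (F × F)} {y : F}
    (hy : some y ∉ directionSet F U) : Set.InjOn (fun P : F × F => P.2 - P.1 * y) U := by
  intro P hP Q hQ h
  by_contra hne
  simp only at h
  by_cases h1 : P.1 = Q.1
  · refine hne (Prod.ext h1 ?_)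
    rw [h1] at h
    exact sub_left_injective h
  · refine hy ⟨P, hP, Q, hQ, hne, Or.inr ⟨h1, ?_⟩⟩
    rw [Option.some_inj, eq_div_iff (sub_ne_zero.mpr (Ne.symm h1))]
    linear_combination h

theorem prod_X_sub_C_dvd_X_pow_card_sub_X [Fintype F] {ι : Type*} (s : Finset ι) (f : ι → F)
    (hf : Set.InjOn f s) : ∏ i ∈ s, (X - C (f i)) ∣ X ^ Fintype.card F - X := by
  refine Finset.prod_dvd_of_coprime ?_ ?_
  · intro a ha b hb hab
    exact isCoprime_X_sub_C_of_isUnit_sub (sub_ne_zero.mpr (hf.ne ha hb hab)).isUnit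
  · intro i _
    rw [dvd_iff_isRoot]
    simp [FiniteField.pow_card]

theorem card_mul_card_le_ncard_directionSet_add [Fintype F] (p : ℕ) [Fact p.Prime] [CharP F p]
    (k : ℕ) (hF : Fintype.card F = p ^ k) (A B : Finset F) (hA : 2 ≤ A.card) (hB : 2 ≤ B.card)
    (hAB : A.card * B.card ≤ p ^ k) (s : ℕ) (hs : ∀ t, p ^ t * B.card ≤ p ^ k → t ≤ s) :
    A.card * B.card + 1 ≤
      (directionSet F {P : F × F | P.1 ∈ A ∧ P.2 ∈ B}).ncard + p ^ s * (B.card - 1) := by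
  classical
  set D := directionSet F {P : F × F | P.1 ∈ A ∧ P.2 ∈ B} with hD
  have hDtwo : 2 ≤ D.ncard := (Set.one_lt_ncard_iff).mpr
    ⟨none, some 0, none_mem_directionSet hA hB, some_zero_mem_directionSet hA hB, by simp⟩
  by_cases hbig : A.card * B.card + 1 ≤ D.ncard
  · omega
  set S : Finset F := Finset.univ.filter fun y => some y ∉ D with hS
  have hScard : p ^ k + 1 ≤ S.card + D.ncard := by
    have h1 := Set.ncard_add_ncard_compl D
    rw [Nat.card_eq_fintype_card, Fintype.card_option, hF] at h1
    have h2 : Dᶜ ⊆ some '' (S : Set F) := by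
      rintro (_ | y) hy
      · exact absurd (none_mem_directionSet hA hB) hy
      · exact ⟨y, by simpa [hS] using hy, rfl⟩
    have h3 := (Set.ncard_le_ncard h2).trans (Set.ncard_image_le S.finite_toSet)
    rw [Set.ncard_coe_finset] at h3
    omega
  set R : F[X][X] := ∏ P ∈ A ×ˢ B, (X - C (C P.2 - C P.1 * X)) with hR
  have hRmonic : R.Monic := monic_prod_X_sub_C _ _
  have hRdeg : R.natDegree = A.card * B.card := by
    rw [hR, natDegree_finsetProd_X_sub_C_eq_card, Finset.card_product]
  have hRtotal : TotalDegreeLE R R.natDegree := by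
    rw [hRdeg, ← Finset.card_product]
    refine TotalDegreeLE.prod _ _ fun P _ => TotalDegreeLE.X.sub (TotalDegreeLE.C ?_)
    compute_degree
  have hRmap (y : F) : R.map (evalRingHom y) = ∏ P ∈ A ×ˢ B, (X - C (P.2 - P.1 * y)) := by
    simp [hR, Polynomial.map_prod]
  have hpos : 2 * 2 ≤ A.card * B.card := Nat.mul_le_mul hA hB
  obtain ⟨g, hgdvd, hgdeg, hg⟩ := hRtotal.exists_remainder hRmonic (by omega) (p ^ k)
  have hgdvd' (y : F) : R.map (evalRingHom y) ∣ X ^ p ^ k - g.map (evalRingHom y) := by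
    simpa using Polynomial.map_dvd (evalRingHom y) hgdvd
  have hgS (y : F) (hy : y ∈ S) : g.map (evalRingHom y) = X := by
    have h1 : R.map (evalRingHom y) ∣ X ^ p ^ k - X := by
      rw [hRmap, ← hF]
      refine prod_X_sub_C_dvd_X_pow_card_sub_X _ (fun P : F × F => P.2 - P.1 * y) ?_
      convert injOn_sub_mul_of_notMem_directionSet (Finset.mem_filter.mp hy).2 using 1
      ext P
      simp
    have h2 := dvd_sub h1 (hgdvd' y)
    rw [sub_sub_sub_cancel_left] at h2
    refine sub_eq_zero.mp (eq_zero_of_dvd_of_degree_lt h2 ?_)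
    rw [degree_eq_natDegree (hRmonic.map _).ne_zero, hRmonic.natDegree_map]
    refine (degree_sub_le _ _).trans_lt (max_lt (degree_map_le.trans_lt hgdeg) ?_)
    rw [degree_X, hRdeg]
    exact_mod_cast (by omega : 1 < A.card * B.card)
  have hgcoeff (j : ℕ) (hj : D.ncard ≤ j) : g.coeff j = 0 := by
    by_cases hjk : p ^ k < j
    · ext i
      exact hg i j (by omega)
    refine eq_zero_of_natDegree_lt_card_of_eval_eq_zero' _ S (fun y hy => ?_) ?_
    · have := congrArg (fun f => coeff f j) (hgS y hy)
      simpa [coeff_X, show 1 ≠ j by omega] using this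
    · have := hg.natDegree_coeff_le j
      omega
  set h := g.map (evalRingHom 0) with hh
  have hhdeg : h.natDegree < D.ncard := by
    refine (Nat.lt_iff_le_pred (by omega)).mpr (natDegree_le_iff_coeff_eq_zero.mpr fun j hj => ?_)
    rw [hh, coeff_map, hgcoeff j (by omega), map_zero]
  have hhdvd : (∏ b ∈ B, (X - C b)) ^ A.card ∣ X ^ p ^ k - h := by
    have := hgdvd' 0
    rw [hRmap, Finset.prod_product] at this
    simpa using this
  obtain ⟨t, ht1, ht2⟩ := exists_le_natDegree_of_pow_dvd_X_pow_sub p B hB k A.card h (by omega)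
    (by omega) hhdvd
  have := Nat.mul_le_mul_right (B.card - 1)
    (Nat.pow_le_pow_right (Fact.out : p.Prime).pos (hs t ht1))
  omega

theorem ncard_directionSet_swap_le [Finite F] (A B : Finset F) :
    (directionSet F {P : F × F | P.1 ∈ B ∧ P.2 ∈ A}).ncard ≤
      (directionSet F {P : F × F | P.1 ∈ A ∧ P.2 ∈ B}).ncard := by
  classical
  refine (Set.ncard_le_ncard (t := (fun o : Option F => o.elim (some 0)
    fun m => if m = 0 then none else some m⁻¹) '' directionSet F {P : F × F | P.1 ∈ A ∧ P.2 ∈ B})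
    ?_ (Set.toFinite _)).trans (Set.ncard_image_le (Set.toFinite _))
  rintro x ⟨P, hP, Q, hQ, hne, h⟩
  have hne' : P.swap ≠ Q.swap := fun h => hne (Prod.swap_injective h)
  by_cases h2 : P.2 = Q.2
  · have h1 : P.1 ≠ Q.1 := fun h1 => hne (Prod.ext h1 h2)
    refine ⟨none, ⟨P.swap, hP.symm, Q.swap, hQ.symm, hne', Or.inl ⟨h2, rfl⟩⟩, ?_⟩
    rcases h with ⟨h, _⟩ | ⟨_, rfl⟩
    · exact absurd h h1
    · simp [h2]
  · refine ⟨some ((Q.1 - P.1) / (Q.2 - P.2)),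
      ⟨P.swap, hP.symm, Q.swap, hQ.symm, hne', Or.inr ⟨h2, rfl⟩⟩, ?_⟩
    have h2' : Q.2 - P.2 ≠ 0 := sub_ne_zero.mpr (Ne.symm h2)
    rcases h with ⟨h, rfl⟩ | ⟨h, rfl⟩
    · simp [h]
    · have h' : Q.1 - P.1 ≠ 0 := sub_ne_zero.mpr (Ne.symm h)
      simp [h', h2']

end Field

theorem stmt5 (p : ℕ) (hp : p.Prime) (hodd : Odd p)
    (q : ℕ) (hq : ∃ k : ℕ, 0 < k ∧ q = p ^ k)
    (F : Type*) [Field F] [Fintype F] (hF : Fintype.card F = q)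
    (A B : Finset F) (m n : ℕ) (hm : A.card = m) (hn : B.card = n)
    (hm2 : 2 ≤ m) (hn2 : 2 ≤ n) (hmn : m * n ≤ q)
    (s1 : ℕ) (hs1 : p ^ s1 * n ≤ q) (hs1max : ∀ s : ℕ, p ^ s * n ≤ q → s ≤ s1)
    (s2 : ℕ) (hs2 : p ^ s2 * m ≤ q) (hs2max : ∀ s : ℕ, p ^ s * m ≤ q → s ≤ s2) :
    (m * n : ℤ) - min ((p : ℤ) ^ s1 * (n - 1)) ((p : ℤ) ^ s2 * (m - 1)) + 1 ≤
      ((directionSet F {P : F × F | P.1 ∈ A ∧ P.2 ∈ B}).ncard : ℤ) := by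
  obtain ⟨k, hk, rfl⟩ := hq
  subst hm hn
  have : Fact p.Prime := ⟨hp⟩
  have : CharP F p := charP_of_card_eq_prime_pow hF
  have h1 := card_mul_card_le_ncard_directionSet_add p k hF A B hm2 hn2 hmn s1 hs1max
  have h2 := (card_mul_card_le_ncard_directionSet_add p k hF B A hn2 hm2
    (by rwa [mul_comm]) s2 hs2max).trans
    (Nat.add_le_add_right (ncard_directionSet_swap_le A B) _)
  rw [mul_comm B.card] at h2
  zify [(by omega : 1 ≤ A.card), (by omega : 1 ≤ B.card)] at h1 h2
  rcases min_choice ((p : ℤ) ^ s1 * (B.card - 1)) ((p : ℤ) ^ s2 * (A.card - 1)) with h | h <;>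
    rw [h] <;> linarith
end

section
/- Let p be an odd prime, q a power of p, and K a proper subfield of F_q. Let d ≥ 2 be a divisor of (q-1)/(|K|-1) such that q < d·|K|·(|K|+1). Let r be the remainder of (q-1)/d upon division by p·|K|. If r < (p-1)·|K|, then ω(GP(q,d)) = |K|. -/
/-- A subset `C` of the field `F` is a clique of the `d`-Paley graph `GP(F,d)`:
all pairwise differences of distinct elements are nonzero `d`-th powers. -/
def IsPaleyClique (F : Type*) [Field F] (d : ℕ) (C : Set F) : Prop :=
  ∀ x ∈ C, ∀ y ∈ C, x ≠ y → ∃ z : F, z ≠ 0 ∧ x - y = z ^ d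

/-- The clique number of the `d`-Paley graph on `F`: the maximum size of a clique. -/
noncomputable def paleyCliqueNumber (F : Type*) [Field F] (d : ℕ) : ℕ :=
  sSup {n : ℕ | ∃ C : Set F, IsPaleyClique F d C ∧ C.ncard = n}

open Polynomial in
/-- Divided differences: for `N + 1` nodes there are weights whose moments of order below `N` vanish
about any centre, and whose `N`-th moment is normalised. -/
theorem exists_weights_moment {F : Type*} [Field F] (A : Finset F) (N : ℕ) (hA : A.card = N + 1) :
    ∃ c : F → F, ∀ b : F, ∀ j ≤ N,
      ∑ i ∈ A, c i * (b - i) ^ j = if j = N then (-1) ^ N else 0 := by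
  classical
  refine ⟨fun i => (∏ j ∈ A.erase i, (i - j))⁻¹, fun b j hj => ?_⟩
  have hdeg : ((X - C b) ^ j : F[X]).degree < A.card := by
    rw [degree_pow, degree_X_sub_C, hA, nsmul_one]
    exact_mod_cast Nat.lt_succ_of_le hj
  have h := Lagrange.coeff_eq_sum (v := id) (Set.injOn_id _) hdeg
  have hsum : ∑ i ∈ A, (∏ j ∈ A.erase i, (i - j))⁻¹ * (b - i) ^ j =
      (-1) ^ j * ((X - C b) ^ j : F[X]).coeff N := by
    rw [hA, Nat.add_sub_cancel] at h
    rw [h, Finset.mul_sum]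
    refine Finset.sum_congr rfl fun i _ => ?_
    rw [← neg_sub i b, neg_pow]
    simp only [id, eval_pow, eval_sub, eval_X, eval_C]
    ring
  rw [hsum]
  split_ifs with hjN
  · subst hjN
    have hmonic := ((monic_X_sub_C b).pow j).coeff_natDegree
    rw [natDegree_pow, natDegree_X_sub_C, mul_one] at hmonic
    rw [hmonic, mul_one]
  · rw [coeff_eq_zero_of_natDegree_lt, mul_zero]
    rw [natDegree_pow, natDegree_X_sub_C]
    omega

open Polynomial in
/-- The Hanson-Petridis bound: if all differences of distinct elements of an `(N + 1)`-element set are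
`m`-th roots of unity and `(N + m).choose N` is nonzero in the field, then `(N + 1) * N ≤ m`. -/
theorem card_mul_le_of_sub_pow_eq_one {F : Type*} [Field F] (A : Finset F) (N m : ℕ) (hm : 0 < m)
    (hA : A.card = N + 1) (hpow : ∀ x ∈ A, ∀ y ∈ A, x ≠ y → (x - y) ^ m = 1)
    (hchoose : ((N + m).choose N : F) ≠ 0) : (N + 1) * N ≤ m := by
  classical
  obtain ⟨c, hc⟩ := exists_weights_moment A N hA
  set f : F[X] := ∑ i ∈ A, C (c i) * (X + C (-i)) ^ (N + m) - C ((-1) ^ N) with hf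
  have hcoeff : ∀ k, f.coeff k = (∑ i ∈ A, c i * (0 - i) ^ (N + m - k)) * ((N + m).choose k : F) -
      (C ((-1) ^ N) : F[X]).coeff k := by
    intro k
    simp only [hf, coeff_sub, finsetSum_coeff, coeff_C_mul, coeff_X_add_C_pow, zero_sub,
      Finset.sum_mul, mul_assoc]
  have htaylor : ∀ a k, (taylor a f).coeff k =
      (∑ i ∈ A, c i * (a - i) ^ (N + m - k)) * ((N + m).choose k : F) -
      (C ((-1) ^ N) : F[X]).coeff k := by
    intro a k
    have : taylor a f = ∑ i ∈ A, C (c i) * (X + C (a - i)) ^ (N + m) - C ((-1) ^ N) := by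
      simp [hf, taylor_mul, taylor_pow, sub_eq_add_neg, add_assoc]
    simp only [this, coeff_sub, finsetSum_coeff, coeff_C_mul, coeff_X_add_C_pow,
      Finset.sum_mul, mul_assoc]
  have hne : f ≠ 0 := by
    intro h0
    have h := hcoeff m
    rw [Nat.add_sub_cancel, hc 0 N le_rfl, if_pos rfl, coeff_C_of_ne_zero hm.ne', h0, coeff_zero,
      sub_zero, Nat.choose_symm_add.symm] at h
    exact mul_ne_zero (pow_ne_zero _ (neg_ne_zero.2 one_ne_zero)) hchoose h.symm
  have hdeg : f.natDegree ≤ m := by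
    rw [natDegree_le_iff_coeff_eq_zero]
    intro k hk
    rw [hcoeff, coeff_C_of_ne_zero (by omega), sub_zero]
    by_cases hkN : k ≤ N + m
    · rw [hc 0 _ (by omega), if_neg (by omega), zero_mul]
    · rw [Nat.choose_eq_zero_of_lt (by omega), Nat.cast_zero, mul_zero]
  have hroot : ∀ a ∈ A, (X - C a) ^ N ∣ f := by
    intro a ha
    have hX : X ^ N ∣ taylor a f := by
      rw [X_pow_dvd_iff]
      intro k hk
      have hsum : ∑ i ∈ A, c i * (a - i) ^ (N + m - k) = ∑ i ∈ A, c i * (a - i) ^ (N - k) := by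
        refine Finset.sum_congr rfl fun i hi => ?_
        rcases eq_or_ne a i with rfl | hai
        · rw [sub_self, zero_pow (by omega), zero_pow (by omega)]
        · rw [show N + m - k = (N - k) + m by omega, pow_add, hpow a ha i hi hai, mul_one]
      rw [htaylor, hsum, hc a _ (Nat.sub_le _ _)]
      rcases Nat.eq_zero_or_pos k with rfl | hk0
      · rw [if_pos (Nat.sub_zero N), Nat.choose_zero_right, Nat.cast_one, mul_one,
          coeff_C_zero, sub_self]
      · rw [if_neg (by omega), coeff_C_of_ne_zero hk0.ne', zero_mul, sub_zero]
    have h := map_dvd (taylorAlgHom (-a)) hX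
    simpa [taylor_taylor, sub_eq_add_neg] using h
  have hprod : ∏ a ∈ A, (X - C a) ^ N ∣ f := by
    refine Finset.prod_dvd_of_coprime (fun a _ b _ hab => ?_) hroot
    exact (pairwise_coprime_X_sub_C Function.injective_id hab).pow
  have hle := (natDegree_le_of_dvd hprod hne).trans hdeg
  rwa [natDegree_prod_of_monic _ _ fun a _ => (monic_X_sub_C a).pow N,
    Finset.sum_congr rfl fun a _ => by rw [natDegree_pow, natDegree_X_sub_C, mul_one],
    Finset.sum_const, hA, smul_eq_mul] at hle

/-- A case of the theorem of Lucas: `n.choose (p ^ s)` is congruent mod `p` to the `s`-th digit of `n`. -/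
theorem Nat.choose_prime_pow_modEq (p : ℕ) [Fact p.Prime] (s n : ℕ) :
    n.choose (p ^ s) ≡ n / p ^ s [MOD p] := by
  induction s generalizing n with
  | zero => simp [Nat.ModEq.refl]
  | succ s ih =>
    have h := Choose.choose_modEq_choose_mod_mul_choose_div_nat (n := n) (k := p ^ (s + 1)) (p := p)
    have hp : 0 < p := (Fact.out : p.Prime).pos
    rw [pow_succ, Nat.mul_mod_left, Nat.mul_div_cancel _ hp, Nat.choose_zero_right, one_mul] at h
    rw [pow_succ, mul_comm (p ^ s) p, ← Nat.div_div_eq_div_mul, mul_comm p (p ^ s)]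
    exact h.trans (ih (n / p))

theorem not_dvd_choose_add_of_mod_lt (p : ℕ) [Fact p.Prime] (s m : ℕ)
    (h : m % (p * p ^ s) < (p - 1) * p ^ s) : ¬ p ∣ (p ^ s + m).choose (p ^ s) := by
  have hp : p.Prime := Fact.out
  have hs : 0 < p ^ s := pow_pos hp.pos s
  have hdigit : m / p ^ s % p < p - 1 := by
    rw [← Nat.mod_mul_right_div_self, Nat.div_lt_iff_lt_mul hs, mul_comm (p ^ s) p]
    exact h
  rw [(Nat.choose_prime_pow_modEq p s _).dvd_iff dvd_rfl, Nat.add_div_left _ hs,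
    Nat.dvd_iff_mod_eq_zero, Nat.add_mod, Nat.mod_eq_of_lt hp.one_lt,
    Nat.mod_eq_of_lt (by omega)]
  omega

/-- In a finite field, an `n`-th root of unity is a `d`-th power whenever `d * n` divides the order of
the unit group. -/
theorem FiniteField.exists_eq_pow_of_pow_eq_one {F : Type*} [Field F] [Fintype F] {d n : ℕ}
    (h : d * n ∣ Fintype.card F - 1) {x : F} (hx : x ≠ 0) (hxn : x ^ n = 1) :
    ∃ z : F, z ≠ 0 ∧ x = z ^ d := by
  have hcard : 0 < Fintype.card F - 1 := Nat.sub_pos_of_lt Fintype.one_lt_card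
  obtain ⟨g, hg⟩ := IsCyclic.exists_generator (α := Fˣ)
  have horder : orderOf g = Fintype.card F - 1 := by
    rw [orderOf_eq_card_of_forall_mem_zpowers hg, Nat.card_units, Nat.card_eq_fintype_card]
  have hn : 0 < n := by
    rcases Nat.eq_zero_or_pos n with rfl | hn
    · rw [mul_zero, zero_dvd_iff] at h
      omega
    · exact hn
  obtain ⟨t, ht⟩ := (mem_powers_iff_mem_zpowers.2 (hg (Units.mk0 x hx)))
  have ht : g ^ t = Units.mk0 x hx := ht
  have hdvd : d * n ∣ t * n := by
    refine (horder ▸ h).trans (orderOf_dvd_of_pow_eq_one ?_)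
    rw [pow_mul, ht]
    ext
    simpa using hxn
  obtain ⟨u, rfl⟩ := Nat.dvd_of_mul_dvd_mul_right hn hdvd
  refine ⟨((g ^ u : Fˣ) : F), Units.ne_zero _, ?_⟩
  rw [← Units.val_pow_eq_pow_val, ← pow_mul, mul_comm u d, ht, Units.val_mk0]

theorem isPaleyClique_subfield {F : Type*} [Field F] [Fintype F] (K : Subfield F) {d : ℕ}
    (h : d * (Nat.card K - 1) ∣ Fintype.card F - 1) : IsPaleyClique F d (K : Set F) := by
  intro x hx y hy hxy
  refine FiniteField.exists_eq_pow_of_pow_eq_one h (sub_ne_zero.2 hxy) ?_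
  have := Fintype.ofFinite K
  have hK := FiniteField.pow_card_sub_one_eq_one (⟨x - y, K.sub_mem hx hy⟩ : K)
    fun h0 => sub_ne_zero.2 hxy (congrArg Subtype.val h0)
  rw [Nat.card_eq_fintype_card]
  exact congrArg Subtype.val hK

theorem Subfield.natCard_sub_one_dvd {F : Type*} [Field F] [Fintype F] (K : Subfield F) :
    Nat.card K - 1 ∣ Fintype.card F - 1 := by
  rw [← Nat.card_eq_fintype_card, Module.natCard_eq_pow_finrank (K := K) (V := F)]
  simpa using Nat.sub_dvd_pow_sub_pow (Nat.card K) 1 (Module.finrank K F)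

theorem stmt10 (p : ℕ) (hp : p.Prime) (hodd : Odd p)
    (q : ℕ) (hq : ∃ k : ℕ, 0 < k ∧ q = p ^ k)
    (F : Type*) [Field F] [Fintype F] (hF : Fintype.card F = q)
    (K : Subfield F) (hK : K ≠ ⊤)
    (d : ℕ) (hd : 2 ≤ d) (hdvd : d ∣ (q - 1) / (Nat.card K - 1))
    (hqd : q < d * Nat.card K * (Nat.card K + 1))
    (r : ℕ) (hr : r = ((q - 1) / d) % (p * Nat.card K))
    (hrK : r < (p - 1) * Nat.card K) :
    paleyCliqueNumber F d = Nat.card K := by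
  subst hF hr
  have : Fact p.Prime := ⟨hp⟩
  obtain ⟨k, hk, hcard⟩ := hq
  have : CharP F p := by
    obtain ⟨p', hp'⟩ := CharP.exists F
    obtain ⟨n, hprime, hn⟩ := FiniteField.card F p'
    have hdvd : p' ∣ p ^ k := by
      rw [← hcard, hn]
      exact dvd_pow_self _ n.pos.ne'
    rwa [(Nat.prime_dvd_prime_iff_eq hprime hp).1 (hprime.dvd_of_dvd_pow hdvd)] at hp'
  obtain ⟨s, hs⟩ : ∃ s : ℕ, Nat.card K = p ^ s := by
    have := Fintype.ofFinite K
    have : CharP K p := inferInstance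
    obtain ⟨n, -, hn⟩ := FiniteField.card K p
    exact ⟨n, by rw [Nat.card_eq_fintype_card, hn]⟩
  have hKcard : 1 < Nat.card K := Finite.one_lt_card
  have hdK : d * (Nat.card K - 1) ∣ Fintype.card F - 1 := by
    obtain ⟨e, he⟩ := K.natCard_sub_one_dvd
    rw [he, Nat.mul_div_cancel_left _ (by omega)] at hdvd
    rw [he, mul_comm]
    exact mul_dvd_mul_left _ hdvd
  have hdF : d ∣ Fintype.card F - 1 := (dvd_mul_right _ _).trans hdK
  obtain ⟨m, hm⟩ := hdF
  have hF1 : 1 < Fintype.card F := Fintype.one_lt_card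
  have hm0 : 0 < m := by
    rcases Nat.eq_zero_or_pos m with rfl | h
    · omega
    · exact h
  rw [hm, Nat.mul_div_cancel_left _ (by omega), hs] at hrK
  have hbound : ∀ C : Set F, IsPaleyClique F d C → C.ncard ≤ Nat.card K := by
    intro C hC
    by_contra! hlt
    obtain ⟨B, hBC, hB⟩ := Set.exists_subset_card_eq (Nat.succ_le_of_lt hlt)
    have hle := card_mul_le_of_sub_pow_eq_one B.toFinite.toFinset (p ^ s) m hm0
      (by rw [← Set.ncard_eq_toFinset_card, hB, hs])
      (fun x hx y hy hxy => by
        obtain ⟨z, hz, hzd⟩ := hC x (hBC (by simpa using hx)) y (hBC (by simpa using hy)) hxy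
        rw [hzd, ← pow_mul, ← hm, FiniteField.pow_card_sub_one_eq_one z hz])
      (by
        rw [Ne, CharP.cast_eq_zero_iff F p]
        exact not_dvd_choose_add_of_mod_lt p s m hrK)
    rw [hs] at hqd
    have := Nat.mul_le_mul_left d hle
    rw [mul_comm (p ^ s + 1), ← mul_assoc] at this
    have hlt' : d * m < d * p ^ s * (p ^ s + 1) := by omega
    omega
  refine IsGreatest.csSup_eq ⟨⟨K, isPaleyClique_subfield K hdK, rfl⟩, ?_⟩
  rintro n ⟨C, hC, rfl⟩
  exact hbound C hC
end
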